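/- Let d be a positive integer, B the open unit ball of ℂ^d, λ₁, …, λₙ distinct points of B, and z₁, …, zₙ ∈ ℂ. If there exists a holomorphic function φ : B → ℂ with sup_{w∈B} |φ(w)| ≤ 1 and φ(λᵢ) = zᵢ for each i, then the n×n matrix whose (i,j) entry is (1 − zᵢ·conj(zⱼ))·(1 − ⟨λᵢ,λⱼ⟩)^{-d} is positive semidefinite. -/

import Mathlib

open Complex Metric
open scoped ComplexOrder

namespace SzegoPick
open MeasureTheory

abbrev SV (m : ℕ) := EuclideanSpace ℂ (Fin (m + 1))

/-- A unitarily invariant probability measure on the unit sphere. -/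
structure InvSph {m : ℕ} (σ : Measure (SV m)) : Prop where
  prob : IsProbabilityMeasure σ
  sph : ∀ᵐ x ∂σ, x ∈ sphere (0 : SV m) 1
  inv : ∀ U : SV m ≃ₗᵢ[ℂ] SV m, MeasurePreserving U σ σ

lemma exists_invSph (m : ℕ) : ∃ σ : Measure (SV m), InvSph σ := by
  let _ : InnerProductSpace ℝ (SV m) := InnerProductSpace.rclikeToReal ℂ (SV m)
  let μ : Measure (SV m) := ProbabilityTheory.cond volume (ball (0 : SV m) 1)
  let p : SV m → SV m := fun x => ((‖x‖⁻¹ : ℝ) : ℂ) • x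
  have hp : Measurable p := by fun_prop
  have h0 : (volume (ball (0 : SV m) 1)) ≠ 0 := (measure_ball_pos _ _ one_pos).ne'
  have h1 : (volume (ball (0 : SV m) 1)) ≠ ⊤ := measure_ball_lt_top.ne
  have : IsProbabilityMeasure μ := ProbabilityTheory.cond_isProbabilityMeasure_of_finite h0 h1
  have hU : ∀ U : SV m ≃ₗᵢ[ℂ] SV m, MeasurePreserving U μ μ := by
    intro U
    let W : SV m ≃ₗᵢ[ℝ] SV m := { U.toLinearEquiv.restrictScalars ℝ with norm_map' := U.norm_map }
    have hv : MeasurePreserving U (volume : Measure (SV m)) volume := W.measurePreserving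
    have hpre : U ⁻¹' ball (0 : SV m) 1 = ball 0 1 := by
      ext x; simp
    have := hv.restrict_preimage (s := ball (0 : SV m) 1) measurableSet_ball
    rw [hpre] at this
    exact this.smul_measure _
  refine ⟨μ.map p, Measure.isProbabilityMeasure_map hp.aemeasurable, ?_, ?_⟩
  · refine (ae_map_iff hp.aemeasurable (p := fun x => x ∈ sphere (0 : SV m) 1)
      (isClosed_sphere.measurableSet)).2 ?_
    have : ∀ᵐ x ∂μ, x ≠ 0 := by
      have hac : μ ≪ volume := ProbabilityTheory.cond_absolutelyContinuous
      apply hac.ae_le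
      change ∀ᵐ x ∂(volume : Measure (SV m)), x ≠ 0
      rw [ae_iff]; simp
    filter_upwards [this] with x hx
    have : ‖x‖ ≠ 0 := by simpa using hx
    simp [p, norm_smul, this]
  · intro U
    refine ⟨U.continuous.measurable, ?_⟩
    rw [Measure.map_map U.continuous.measurable hp]
    have : U ∘ p = p ∘ U := by
      ext1 x; simp [p]
    rw [this, ← Measure.map_map hp U.continuous.measurable, (hU U).map_eq]

variable {m : ℕ} {σ : Measure (SV m)}

lemma InvSph.restrict (h : InvSph σ) : σ.restrict (sphere (0 : SV m) 1) = σ :=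
  Measure.restrict_eq_self_of_ae_mem h.sph

lemma InvSph.integrable (h : InvSph σ) {F : SV m → ℂ}
    (hF : ContinuousOn F (sphere (0 : SV m) 1)) : Integrable F σ := by
  have := h.prob
  have := hF.integrableOn_compact (μ := σ) (isCompact_sphere _ _)
  rwa [IntegrableOn, h.restrict] at this

lemma InvSph.comp (h : InvSph σ) (U : SV m ≃ₗᵢ[ℂ] SV m) (F : SV m → ℂ) :
    ∫ x, F (U x) ∂σ = ∫ x, F x ∂σ :=
  (h.inv U).integral_comp U.toHomeomorph.measurableEmbedding F

lemma InvSph.zero (h : InvSph σ) (U : SV m ≃ₗᵢ[ℂ] SV m) (F : SV m → ℂ) (c : ℂ) (hc : c ≠ 1)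
    (hF : ∀ x, F (U x) = c * F x) : ∫ x, F x ∂σ = 0 := by
  have h1 := h.comp U F
  simp only [hF, integral_const_mul] at h1
  have : (c - 1) * ∫ x, F x ∂σ = 0 := by linear_combination h1
  rcases mul_eq_zero.1 this with h2 | h2
  · exact absurd (sub_eq_zero.1 h2) hc
  · exact h2

/-- multiplication by phases -/
noncomputable def phase (u : Fin (m + 1) → ℂ) (hu : ∀ i, ‖u i‖ = 1) : SV m ≃ₗᵢ[ℂ] SV m :=
  LinearIsometryEquiv.piLpCongrRight 2 fun i =>
    { LinearEquiv.smulOfNeZero ℂ ℂ (u i) (by intro h0; have := hu i; simp [h0] at this) with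
      norm_map' := fun x => by
        change ‖u i • x‖ = _
        rw [norm_smul, hu i, one_mul] }

@[simp] lemma phase_apply (u : Fin (m + 1) → ℂ) (hu : ∀ i, ‖u i‖ = 1) (x : SV m) (i) :
    phase u hu x i = u i * x i := rfl

lemma exists_rot (v : SV m) :
    ∃ U : SV m ≃ₗᵢ[ℂ] SV m, U (EuclideanSpace.single 0 (‖v‖ : ℂ)) = v := by
  by_cases hv : v = 0
  · refine ⟨LinearIsometryEquiv.refl ℂ _, ?_⟩
    simp [hv]
  have hn : ‖v‖ ≠ 0 := by simpa using hv
  have ho : Orthonormal ℂ (({0} : Set (Fin (m+1))).domRestrict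
      (fun _ : Fin (m + 1) => ((‖v‖⁻¹ : ℝ) : ℂ) • v)) := by
    rw [orthonormal_iff_ite]
    rintro ⟨i, hi⟩ ⟨j, hj⟩
    have : i = j := by rw [Set.mem_singleton_iff.1 hi, Set.mem_singleton_iff.1 hj]
    subst this
    rw [if_pos rfl, Set.domRestrict_apply, inner_self_eq_norm_sq_to_K, norm_smul]
    simp [hn]
  obtain ⟨b, hb⟩ := ho.exists_orthonormalBasis_extension_of_card_eq (by simp)
  refine ⟨b.repr.symm, ?_⟩
  have h0 := hb 0 (by simp)
  rw [show EuclideanSpace.single (0 : Fin (m+1)) (‖v‖ : ℂ)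
    = (‖v‖ : ℂ) • EuclideanSpace.single (0 : Fin (m+1)) (1 : ℂ) by ext i; simp, map_smul,
    OrthonormalBasis.repr_symm_single, h0, smul_smul]
  simp [hn]



noncomputable def TT (w : ℂ) (x : SV m) : SV m :=
  EuclideanSpace.single 0 (x 0) + w • (x - EuclideanSpace.single 0 (x 0))

lemma TT_zero_apply (w : ℂ) (x : SV m) : TT w x 0 = x 0 := by simp [TT]

lemma TT_phase (w : ℂ) (hw : ‖w‖ = 1) : ∃ U : SV m ≃ₗᵢ[ℂ] SV m, ∀ x, U x = TT w x := by
  refine ⟨phase (fun i => if i = 0 then 1 else w) (by intro i; split_ifs <;> simp [hw]), ?_⟩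
  intro x
  ext i
  rw [phase_apply]
  by_cases hi : i = 0
  · subst hi; simp [TT]
  · simp [TT, hi]

lemma TT_norm_le (w : ℂ) (hw : ‖w‖ ≤ 1) (x : SV m) : ‖TT w x‖ ≤ ‖x‖ := by
  rw [EuclideanSpace.norm_eq, EuclideanSpace.norm_eq]
  apply Real.sqrt_le_sqrt
  apply Finset.sum_le_sum
  intro i _
  have : ‖TT w x i‖ ≤ ‖x i‖ := by
    by_cases hi : i = 0
    · subst hi; simp [TT]
    · simp only [TT, PiLp.add_apply, PiLp.smul_apply, PiLp.sub_apply, PiLp.single_apply, hi,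
        if_false, sub_zero, zero_add, smul_eq_mul, norm_mul]
      exact mul_le_of_le_one_left (norm_nonneg _) hw
  gcongr

lemma continuous_TT : Continuous (fun p : ℂ × SV m => TT p.1 p.2) := by
  have h1 : Continuous (fun x : SV m => (EuclideanSpace.single 0 (x 0) : SV m)) := by
    have : (fun x : SV m => (EuclideanSpace.single 0 (x 0) : SV m)) =
      fun x : SV m => (x 0) • (EuclideanSpace.single 0 (1 : ℂ) : SV m) := by
      ext x i; simp
    rw [this]
    fun_prop
  unfold TT
  have h2 := h1.comp (continuous_snd : Continuous (fun p : ℂ × SV m => p.2))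
  simp only [Function.comp_def] at h2
  fun_prop

lemma InvSph.slice (h : InvSph σ) {R : ℝ} (hR : 1 < R) {F : SV m → ℂ}
    (hF : DifferentiableOn ℂ F (ball 0 R)) {H : ℂ → ℂ} (hH : Continuous H) :
    ∫ x, F x * H (x 0) ∂σ = ∫ x, F (EuclideanSpace.single 0 (x 0)) * H (x 0) ∂σ := by
  have := h.prob
  let f : ℝ → SV m → ℂ := fun θ x => F (TT (circleMap 0 1 θ) x) * H (x 0)
  have hcont : ContinuousOn (Function.uncurry f) (Set.Icc 0 (2 * Real.pi) ×ˢ sphere (0 : SV m) 1) := by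
    have h1 : Continuous (fun p : ℝ × SV m => TT (circleMap 0 1 p.1) p.2) :=
      continuous_TT.comp (((continuous_circleMap 0 1).comp continuous_fst).prodMk continuous_snd)
    have h2 : Continuous (fun p : ℝ × SV m => H (p.2 0)) := by fun_prop
    refine ContinuousOn.mul (hF.continuousOn.comp h1.continuousOn ?_) h2.continuousOn
    rintro ⟨θ, x⟩ ⟨_, hx⟩
    have hx' : ‖x‖ = 1 := by simpa using hx
    have := TT_norm_le (circleMap 0 1 θ) (by simp) x
    simp only [mem_ball_zero_iff]
    linarith
  have hint : Integrable (Function.uncurry f)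
      ((volume.restrict (Set.uIoc 0 (2 * Real.pi))).prod σ) := by
    rw [← h.restrict, Measure.prod_restrict]
    have h3 : IntegrableOn (Function.uncurry f)
      (Set.Icc 0 (2 * Real.pi) ×ˢ sphere (0 : SV m) 1) (volume.prod σ) :=
      hcont.integrableOn_compact (isCompact_Icc.prod (isCompact_sphere _ _))
    refine h3.mono_set (Set.prod_mono ?_ le_rfl)
    rw [Set.uIoc_of_le Real.two_pi_pos.le]
    exact Set.Ioc_subset_Icc_self
  have hsw := intervalIntegral_integral_swap hint
  have hl : ∀ θ : ℝ, ∫ x, f θ x ∂σ = ∫ x, F x * H (x 0) ∂σ := by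
    intro θ
    obtain ⟨U, hU⟩ := TT_phase (m := m) (circleMap 0 1 θ) (by simp)
    rw [← h.comp U (fun x => F x * H (x 0))]
    simp only [f, hU, TT_zero_apply]
  have hr : ∀ᵐ x ∂σ, ∫ θ in 0..2 * Real.pi, f θ x =
      (2 * Real.pi) • (F (EuclideanSpace.single 0 (x 0)) * H (x 0)) := by
    filter_upwards [h.sph] with x hx
    have hx' : ‖x‖ = 1 := by simpa using hx
    have hd : DiffContOnCl ℂ (fun w => F (TT w x)) (ball 0 |1|) := by
      rw [abs_one]
      apply DifferentiableOn.diffContOnCl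
      rw [closure_ball _ one_ne_zero]
      refine hF.comp (t := ball 0 R) ?_ ?_
      · unfold TT; fun_prop
      · intro w hw
        have := TT_norm_le w (by simpa using hw) x
        simp only [mem_ball_zero_iff]
        linarith
    have h5 := hd.circleAverage
    rw [Real.circleAverage_def] at h5
    have h6 : TT 0 x = EuclideanSpace.single 0 (x 0) := by simp [TT]
    rw [h6] at h5
    simp only [f]
    rw [intervalIntegral.integral_mul_const, ← h5, smul_mul_assoc, smul_smul,
      mul_inv_cancel₀ Real.two_pi_pos.ne', one_smul]
  simp only [hl] at hsw
  rw [integral_congr_ae hr, integral_smul, intervalIntegral.integral_const, sub_zero] at hsw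
  exact smul_right_injective ℂ Real.two_pi_pos.ne' hsw

/-- even moments of a coordinate -/
noncomputable def mom (σ : Measure (SV m)) (k : ℕ) : ℂ :=
  ∫ x, x 0 ^ k * (starRingEnd ℂ) (x 0) ^ k ∂σ

lemma exists_phase (j k : ℕ) (hjk : j ≠ k) :
    ∃ c : ℂ, ‖c‖ = 1 ∧ c ^ j * (starRingEnd ℂ) c ^ k ≠ 1 := by
  have hne : (j : ℂ) - k ≠ 0 := sub_ne_zero.2 (by exact_mod_cast hjk)
  refine ⟨Complex.exp (((Real.pi / ((j : ℝ) - k) : ℝ) : ℂ) * I), Complex.norm_exp_ofReal_mul_I _, ?_⟩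
  rw [← Complex.exp_conj, ← Complex.exp_nat_mul, ← Complex.exp_nat_mul, ← Complex.exp_add]
  rw [show (j : ℂ) * (((Real.pi / ((j : ℝ) - k) : ℝ) : ℂ) * I) + (k : ℂ) *
    (starRingEnd ℂ) (((Real.pi / ((j : ℝ) - k) : ℝ) : ℂ) * I) = Real.pi * I by
      rw [map_mul, Complex.conj_ofReal, Complex.conj_I]
      push_cast
      field_simp
      ring]
  rw [Complex.exp_pi_mul_I]
  norm_num

lemma InvSph.orth (h : InvSph σ) (j k : ℕ) (hjk : j ≠ k) :
    ∫ x, x 0 ^ j * (starRingEnd ℂ) (x 0) ^ k ∂σ = 0 := by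
  obtain ⟨c, hc, hc1⟩ := exists_phase j k hjk
  refine h.zero (phase (fun _ => c) (fun _ => hc)) _ _ hc1 ?_
  intro x
  simp only [phase_apply, map_mul]
  ring

lemma sph_coord {x : SV m} (hx : x ∈ sphere (0 : SV m) 1) (i) : ‖x i‖ ≤ 1 := by
  have hx' : ‖x‖ = 1 := by simpa using hx
  rw [← hx']; exact PiLp.norm_apply_le x i

lemma InvSph.norm_integral_le (h : InvSph σ) {F : SV m → ℂ} {C : ℝ}
    (hF : ∀ x ∈ sphere (0 : SV m) 1, ‖F x‖ ≤ C) : ∫ x, ‖F x‖ ∂σ ≤ C := by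
  have := h.prob
  have h1 : ∀ᵐ x ∂σ, ‖‖F x‖‖ ≤ C := by
    filter_upwards [h.sph] with x hx
    simpa using hF x hx
  have := norm_integral_le_of_norm_le_const h1
  simp at this
  exact (le_abs_self _).trans this

lemma InvSph.coef (h : InvSph σ) {R : ℝ} (hR : 1 < R) {F : SV m → ℂ}
    (hF : DifferentiableOn ℂ F (ball 0 R)) {a : ℕ → ℂ} (ha : Summable fun n => ‖a n‖)
    (hs : ∀ w : ℂ, ‖w‖ ≤ 1 → HasSum (fun n => a n * w ^ n) (F (EuclideanSpace.single 0 w)))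
    (k : ℕ) :
    ∫ x, F x * (starRingEnd ℂ) (x 0) ^ k ∂σ = a k * mom σ k := by
  rw [h.slice hR hF (H := fun w => (starRingEnd ℂ) w ^ k) (by fun_prop)]
  have h1 := hasSum_integral_of_summable_integral_norm (μ := σ)
    (F := fun n (x : SV m) => a n * (x 0 ^ n * (starRingEnd ℂ) (x 0) ^ k))
    (fun n => h.integrable (by fun_prop)) (by
      refine Summable.of_nonneg_of_le (fun n => integral_nonneg fun x => norm_nonneg _)
        (fun n => h.norm_integral_le ?_) ha
      intro x hx
      have := sph_coord hx 0
      simp only [norm_mul, norm_pow, RCLike.norm_conj]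
      refine mul_le_of_le_one_right (norm_nonneg _) (mul_le_one₀ (pow_le_one₀ (norm_nonneg _) this)
        (by positivity) (pow_le_one₀ (norm_nonneg _) this)))
  have h2 : ∫ x, ∑' n, a n * (x 0 ^ n * (starRingEnd ℂ) (x 0) ^ k) ∂σ =
      ∫ x, F (EuclideanSpace.single 0 (x 0)) * (starRingEnd ℂ) (x 0) ^ k ∂σ := by
    apply integral_congr_ae
    filter_upwards [h.sph] with x hx
    have := (hs (x 0) (sph_coord hx 0)).mul_right ((starRingEnd ℂ) (x 0) ^ k)
    simp only [← mul_assoc]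
    exact this.tsum_eq
  rw [h2] at h1
  refine h1.unique ?_
  have h3 : a k * mom σ k = ∫ x, a k * (x 0 ^ k * (starRingEnd ℂ) (x 0) ^ k) ∂σ := by
    rw [integral_const_mul]; rfl
  rw [h3]
  apply hasSum_single
  intro j hj
  rw [integral_const_mul, h.orth j k hj, mul_zero]

lemma InvSph.mixed (h : InvSph σ) (k : ℕ) (j : Fin (m + 1)) (hj : j ≠ 0) :
    ((k : ℂ) + 1) * ∫ x, x 0 ^ k * (starRingEnd ℂ) (x 0) ^ k * (x j * (starRingEnd ℂ) (x j)) ∂σ =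
      mom σ (k + 1) := by
  set v : SV m := EuclideanSpace.single 0 1 + EuclideanSpace.single j 1 with hv
  have hv0 : v 0 = 1 := by simp [hv, hj.symm]
  have hvj : v j = 1 := by simp [hv, hj]
  obtain ⟨U, hU⟩ := exists_rot v
  have hin : ∀ x : SV m, inner ℂ x v = (starRingEnd ℂ) (x 0) + (starRingEnd ℂ) (x j) := by
    intro x
    rw [hv, inner_add_right, EuclideanSpace.inner_single_right, EuclideanSpace.inner_single_right]
    simp
  -- first evaluation
  have h1 : ∫ x : SV m, (x 0 ^ k * x j) * (inner ℂ x v) ^ (k + 1) ∂σ = mom σ (k + 1) := by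
    rw [← h.comp U]
    have e1 : ∀ x : SV m, ((U x) 0 ^ k * (U x) j) * (inner ℂ (U x) v) ^ (k + 1) =
        ((U ((‖v‖ : ℂ) • x)) 0 ^ k * (U ((‖v‖ : ℂ) • x)) j) * (starRingEnd ℂ) (x 0) ^ (k + 1) := by
      intro x
      have : inner ℂ (U x) v = (‖v‖ : ℂ) * (starRingEnd ℂ) (x 0) := by
        conv_lhs => rw [← hU]
        rw [LinearIsometryEquiv.inner_map_map, EuclideanSpace.inner_single_right]
      rw [this, map_smul]
      simp only [PiLp.smul_apply, smul_eq_mul]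
      ring
    simp only [e1]
    rw [h.slice (R := 2) (by norm_num)
      (F := fun x => ((U ((‖v‖ : ℂ) • x)) 0 ^ k * (U ((‖v‖ : ℂ) • x)) j))
      (H := fun w => (starRingEnd ℂ) w ^ (k + 1)) ?_ (by fun_prop)]
    · unfold mom
      congr 1
      ext x
      have : U ((‖v‖ : ℂ) • EuclideanSpace.single 0 (x 0)) = x 0 • v := by
        conv_rhs => rw [← hU]
        rw [← map_smul]
        congr 1
        ext i
        simp [mul_comm]
      simp only [this, PiLp.smul_apply, hv0, hvj, smul_eq_mul]
      ring
    · have hd : Differentiable ℂ (fun x : SV m => U ((‖v‖ : ℂ) • x)) :=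
        U.toContinuousLinearEquiv.differentiable.comp (by fun_prop : Differentiable ℂ (fun x : SV m => (‖v‖ : ℂ) • x))
      have hd' : ∀ i, Differentiable ℂ (fun x : SV m => U ((‖v‖ : ℂ) • x) i) := fun i =>
        (EuclideanSpace.proj (𝕜 := ℂ) i).differentiable.comp hd
      exact (((hd' 0).pow k).mul (hd' j)).differentiableOn
  -- second evaluation
  rw [← h1]
  simp only [hin, add_pow, Finset.mul_sum]
  rw [integral_finsetSum _ (fun i _ => h.integrable (by fun_prop))]
  rw [Finset.sum_eq_single k]
  · rw [← integral_const_mul]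
    congr 1
    ext x
    simp
    ring
  · intro i hi hik
    have hi' : i ≤ k + 1 := by simpa [Nat.lt_succ_iff] using hi
    obtain ⟨c, hc, hc1⟩ := exists_phase 1 (k + 1 - i) (by omega)
    refine h.zero (phase (fun l => if l = j then c else 1)
      (by intro l; split_ifs <;> simp [hc])) _ _ hc1 ?_
    intro x
    simp only [phase_apply, hj.symm, if_true, if_false, map_mul, one_mul]
    ring
  · intro hk; simp at hk

lemma InvSph.mom_zero (h : InvSph σ) : mom σ 0 = 1 := by
  have := h.prob
  simp [mom]

lemma InvSph.mom_succ (h : InvSph σ) (k : ℕ) :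
    ((k : ℂ) + 1) * mom σ k = ((k : ℂ) + 1 + m) * mom σ (k + 1) := by
  have h1 : mom σ k = ∑ j : Fin (m + 1),
      ∫ x, x 0 ^ k * (starRingEnd ℂ) (x 0) ^ k * (x j * (starRingEnd ℂ) (x j)) ∂σ := by
    rw [← integral_finsetSum _ (fun i _ => h.integrable (by fun_prop))]
    apply integral_congr_ae
    filter_upwards [h.sph] with x hx
    have hx' : ‖x‖ = 1 := by simpa using hx
    rw [← Finset.mul_sum]
    have : ∑ j, x j * (starRingEnd ℂ) (x j) = 1 := by
      have h2 := EuclideanSpace.norm_sq_eq x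
      rw [hx'] at h2
      simp only [Complex.mul_conj, Complex.normSq_eq_norm_sq]
      rw [← Complex.ofReal_sum, ← h2]
      simp
    rw [this, mul_one]
  rw [h1, Fin.sum_univ_succ, mul_add, Finset.mul_sum]
  rw [Finset.sum_congr rfl (fun i _ => h.mixed k i.succ (Fin.succ_ne_zero i))]
  have h0 : ∫ x, x 0 ^ k * (starRingEnd ℂ) (x 0) ^ k * (x 0 * (starRingEnd ℂ) (x 0)) ∂σ
      = mom σ (k + 1) := by
    unfold mom
    congr 1
    ext x
    ring
  rw [h0]
  simp
  ring

lemma InvSph.mom_eq (h : InvSph σ) (k : ℕ) : ((k + m).choose m : ℂ) * mom σ k = 1 := by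
  induction k with
  | zero => simp [h.mom_zero]
  | succ k ih =>
    have h1 := h.mom_succ k
    have h2 : ((k + m).choose m : ℂ) * (k + 1 + m) = ((k + 1 + m).choose m : ℂ) * (k + 1) := by
      have := Nat.choose_mul_succ_eq (k + m) m
      have h3 : k + m + 1 - m = k + 1 := by omega
      rw [h3] at this
      rw [show k + 1 + m = k + m + 1 by ring]
      have h4 : (((k + m).choose m * (k + m + 1) : ℕ) : ℂ) =
        (((k + m + 1).choose m * (k + 1) : ℕ) : ℂ) := by rw [this]
      push_cast at h4
      linear_combination h4
    have hk : (k : ℂ) + 1 ≠ 0 := by exact_mod_cast Nat.succ_ne_zero k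
    apply mul_left_cancel₀ hk
    linear_combination (-mom σ (k+1)) * h2 - ((k + m).choose m : ℂ) * h1 + (k + 1) * ih

lemma InvSph.repro (h : InvSph σ) {R : ℝ} (hR : 1 < R) {F : SV m → ℂ}
    (hF : DifferentiableOn ℂ F (ball 0 R)) {l : SV m} (hl : ‖l‖ < 1) :
    ∫ x, F x * ((1 - inner ℂ x l) ^ (m + 1))⁻¹ ∂σ = F l := by
  obtain ⟨U, hU⟩ := exists_rot l
  set s : ℂ := (‖l‖ : ℂ) with hs
  have hsn : ‖s‖ < 1 := by simpa [hs] using hl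
  rw [← h.comp U]
  have hin : ∀ x : SV m, inner ℂ (U x) l = s * (starRingEnd ℂ) (x 0) := by
    intro x
    conv_lhs => rw [← hU]
    rw [LinearIsometryEquiv.inner_map_map, EuclideanSpace.inner_single_right]
  simp only [hin]
  set G : SV m → ℂ := fun x => F (U x) with hG
  have hGd : DifferentiableOn ℂ G (ball 0 R) := by
    refine hF.comp U.toContinuousLinearEquiv.differentiable.differentiableOn ?_
    intro x hx
    simpa using hx
  have hGl : F l = G (EuclideanSpace.single 0 s) := by simp only [hG, hU]
  -- Taylor coefficients
  have hg : DifferentiableOn ℂ (fun w : ℂ => G (EuclideanSpace.single 0 w)) (ball 0 R) := by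
    have hlin : (fun w : ℂ => (EuclideanSpace.single 0 w : SV m)) =
        fun w => w • EuclideanSpace.single 0 (1 : ℂ) := by
      ext w i; simp
    refine hGd.comp (f := fun w : ℂ => (EuclideanSpace.single 0 w : SV m)) ?_ ?_
    · rw [hlin]; fun_prop
    · intro w hw; simpa using hw
  obtain ⟨a, hasum⟩ : ∃ a : ℕ → ℂ, ∀ w : ℂ, ‖w‖ ≤ 1 →
      HasSum (fun n => a n * w ^ n) (G (EuclideanSpace.single 0 w)) := by
    refine ⟨fun n => (n.factorial : ℂ)⁻¹ *
      iteratedDeriv n (fun w : ℂ => G (EuclideanSpace.single 0 w)) 0, ?_⟩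
    intro w hw
    have := Complex.hasSum_taylorSeries_on_ball hg (z := w)
      (by simp only [mem_ball_zero_iff]; linarith)
    refine this.congr_fun ?_
    intro n
    simp only [sub_zero, smul_eq_mul]
    ring
  have ha : Summable fun n => ‖a n‖ := by
    have := (hasum 1 (by simp)).summable.norm
    simpa using this
  have hco := h.coef hR hGd ha hasum
  rw [hGl]
  obtain ⟨C, hC⟩ := (isCompact_sphere (0 : SV m) 1).exists_bound_of_continuousOn
    (hGd.continuousOn.mono (by
      intro x hx
      have hx' : ‖x‖ = 1 := by simpa using hx
      simp only [mem_ball_zero_iff]; linarith))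
  have hGc : ContinuousOn G (sphere 0 1) := hGd.continuousOn.mono (by
      intro x hx
      have hx' : ‖x‖ = 1 := by simpa using hx
      simp only [mem_ball_zero_iff]; linarith)
  have hC0 : 0 ≤ C := by
    have hmem : (EuclideanSpace.single 0 1 : SV m) ∈ sphere (0 : SV m) 1 := by simp
    exact (norm_nonneg _).trans (hC _ hmem)
  have h1 := hasSum_integral_of_summable_integral_norm (μ := σ)
    (F := fun n (x : SV m) => (((n + m).choose m : ℂ) * s ^ n) * (G x * (starRingEnd ℂ) (x 0) ^ n))
    (fun n => h.integrable (by fun_prop)) (by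
      have hsum := (summable_choose_mul_geometric_of_norm_lt_one (R := ℂ) m hsn).norm.mul_right C
      refine Summable.of_nonneg_of_le (fun n => integral_nonneg fun x => norm_nonneg _)
        (fun n => h.norm_integral_le ?_) hsum
      intro x hx
      have := sph_coord hx 0
      rw [norm_mul]
      refine mul_le_mul_of_nonneg_left ?_ (norm_nonneg _)
      rw [norm_mul, norm_pow, RCLike.norm_conj]
      exact (mul_le_of_le_one_right (norm_nonneg _) (pow_le_one₀ (norm_nonneg _) this)).trans
        (hC x hx))
  have h2 : ∫ x, ∑' n, (((n + m).choose m : ℂ) * s ^ n) * (G x * (starRingEnd ℂ) (x 0) ^ n) ∂σ =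
      ∫ x, G x * ((1 - s * (starRingEnd ℂ) (x 0)) ^ (m + 1))⁻¹ ∂σ := by
    apply integral_congr_ae
    filter_upwards [h.sph] with x hx
    have hn : ‖s * (starRingEnd ℂ) (x 0)‖ < 1 := by
      rw [norm_mul, RCLike.norm_conj]
      exact (mul_le_of_le_one_right (norm_nonneg _) (sph_coord hx 0)).trans_lt hsn
    have := (hasSum_choose_mul_geometric_of_norm_lt_one m hn).mul_left (G x)
    rw [one_div] at this
    rw [← this.tsum_eq]
    congr 1
    ext n
    rw [mul_pow]
    ring
  rw [h2] at h1
  refine h1.unique ?_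
  refine (hasum s hsn.le).congr_fun ?_
  intro n
  rw [integral_const_mul, hco]
  linear_combination (a n * s ^ n) * h.mom_eq n

/-- Szegő kernel -/
noncomputable def KK (l x : SV m) : ℂ := ((1 - inner ℂ l x) ^ (m + 1))⁻¹

lemma KK_conj (l x : SV m) : (starRingEnd ℂ) (KK l x) = ((1 - inner ℂ x l) ^ (m + 1))⁻¹ := by
  simp [KK]

lemma KK_diff (l : SV m) {R : ℝ} (hlR : ‖l‖ * R ≤ 1) :
    DifferentiableOn ℂ (KK l) (ball 0 R) := by
  intro x hx
  have hx' : ‖x‖ < R := by simpa using hx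
  have hne : 1 - inner ℂ l x ≠ 0 := by
    intro h0
    have h1 : inner ℂ l x = 1 := (sub_eq_zero.1 h0).symm
    have h2 := norm_inner_le_norm (𝕜 := ℂ) l x
    rw [h1, norm_one] at h2
    rcases (norm_nonneg l).eq_or_lt with h3 | h3
    · rw [← h3] at h2; linarith
    · nlinarith
  have h4 : DifferentiableAt ℂ (fun x : SV m => inner ℂ l x) x :=
    (innerSL ℂ l).differentiableAt
  unfold KK
  exact ((((differentiableAt_const _).sub h4).pow _).inv (pow_ne_zero _ hne)).differentiableWithinAt

lemma InvSph.repro_sum (h : InvSph σ) {R : ℝ} (hR : 1 < R) {F : SV m → ℂ}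
    (hF : DifferentiableOn ℂ F (ball 0 R)) {n : ℕ} {l : Fin n → SV m} (hl : ∀ i, ‖l i‖ < 1)
    (hlR : ∀ i, ‖l i‖ * R ≤ 1) (c : Fin n → ℂ) :
    ∫ x, F x * (starRingEnd ℂ) (∑ i, c i * KK (l i) x) ∂σ =
      ∑ i, (starRingEnd ℂ) (c i) * F (l i) := by
  have hsub : sphere (0 : SV m) 1 ⊆ ball 0 R := by
    intro x hx
    have hx' : ‖x‖ = 1 := by simpa using hx
    simp only [mem_ball_zero_iff]; linarith
  have hc := hF.continuousOn.mono hsub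
  have hk := fun i => (KK_diff (l i) (hlR i)).continuousOn.mono hsub
  have e : ∀ x, F x * (starRingEnd ℂ) (∑ i, c i * KK (l i) x) =
      ∑ i, (starRingEnd ℂ) (c i) * (F x * (starRingEnd ℂ) (KK (l i) x)) := by
    intro x
    rw [map_sum, Finset.mul_sum]
    refine Finset.sum_congr rfl fun i _ => ?_
    rw [map_mul]; ring
  simp only [e]
  rw [integral_finsetSum]
  · refine Finset.sum_congr rfl fun i _ => ?_
    rw [integral_const_mul]
    simp only [KK_conj]
    rw [h.repro hR hF (hl i)]
  · intro i _
    refine h.integrable (continuousOn_const.mul (hc.mul ?_))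
    exact Complex.continuous_conj.comp_continuousOn (hk i)

lemma pick_aux {R : ℝ} (hR : 1 < R) {F : SV m → ℂ}
    (hF : DifferentiableOn ℂ F (ball 0 R)) (hF1 : ∀ x ∈ ball (0 : SV m) R, ‖F x‖ ≤ 1)
    {n : ℕ} {l : Fin n → SV m} (hl : ∀ i, ‖l i‖ < 1)
    (hlR : ∀ i, ‖l i‖ * R ≤ 1) (c : Fin n → ℂ) :
    0 ≤ (∑ i, ∑ j, (starRingEnd ℂ) (c i) * ((1 - F (l i) * (starRingEnd ℂ) (F (l j))) *
      KK (l j) (l i)) * c j).re := by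
  obtain ⟨σ, h⟩ := exists_invSph m
  have hsub : sphere (0 : SV m) 1 ⊆ ball 0 R := by
    intro x hx
    have hx' : ‖x‖ = 1 := by simpa using hx
    simp only [mem_ball_zero_iff]; linarith
  set b : Fin n → ℂ := fun i => (starRingEnd ℂ) (F (l i)) * c i with hb
  set g : SV m → ℂ := fun x => ∑ i, c i * KK (l i) x with hg
  set k : SV m → ℂ := fun x => ∑ i, b i * KK (l i) x with hk
  have hgd : DifferentiableOn ℂ g (ball 0 R) :=
    DifferentiableOn.fun_sum fun i _ => (KK_diff (l i) (hlR i)).const_mul _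
  have hkd : DifferentiableOn ℂ k (ball 0 R) :=
    DifferentiableOn.fun_sum fun i _ => (KK_diff (l i) (hlR i)).const_mul _
  have hgg := h.repro_sum hR hgd hl hlR c
  have hkk := h.repro_sum hR hkd hl hlR b
  have hfk := h.repro_sum hR (hF.mul hkd) hl hlR c
  have hgc := hgd.continuousOn.mono hsub
  have hkc := hkd.continuousOn.mono hsub
  have hFc := hF.continuousOn.mono hsub
  have hgc' : ContinuousOn (fun x => (starRingEnd ℂ) (g x)) (sphere 0 1) :=
    Complex.continuous_conj.comp_continuousOn hgc
  have hkc' : ContinuousOn (fun x => (starRingEnd ℂ) (k x)) (sphere 0 1) :=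
    Complex.continuous_conj.comp_continuousOn hkc
  have i1 : Integrable (fun x => g x * (starRingEnd ℂ) (g x)) σ := h.integrable (hgc.mul hgc')
  have i2 : Integrable (fun x => k x * (starRingEnd ℂ) (k x)) σ := h.integrable (hkc.mul hkc')
  have i3 : Integrable (fun x => (F x * k x) * (starRingEnd ℂ) (g x)) σ :=
    h.integrable ((hFc.mul hkc).mul hgc')
  have i12 : Integrable (fun x => g x * (starRingEnd ℂ) (g x) + k x * (starRingEnd ℂ) (k x)) σ :=
    i1.add i2
  have hfk' : ∫ x, (F x * k x) * (starRingEnd ℂ) (g x) ∂σ =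
      ∑ i, (starRingEnd ℂ) (b i) * k (l i) := by
    refine hfk.trans (Finset.sum_congr rfl fun i _ => ?_)
    simp only [hb, map_mul, Complex.conj_conj, Pi.mul_apply]
    ring
  have key : 0 ≤ (∫ x, (g x * (starRingEnd ℂ) (g x) + k x * (starRingEnd ℂ) (k x)
      - 2 * ((F x * k x) * (starRingEnd ℂ) (g x))) ∂σ).re := by
    have hi := i12.sub (i3.const_mul 2)
    have hre := integral_re hi
    simp only [Pi.sub_apply] at hre
    change 0 ≤ RCLike.re (K := ℂ) _
    rw [← hre]
    apply integral_nonneg_of_ae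
    filter_upwards [h.sph] with x hx
    have hFx := hF1 x (hsub hx)
    change 0 ≤ (g x * (starRingEnd ℂ) (g x) + k x * (starRingEnd ℂ) (k x)
      - 2 * ((F x * k x) * (starRingEnd ℂ) (g x))).re
    have h1 : ((F x * k x) * (starRingEnd ℂ) (g x)).re ≤ ‖k x‖ * ‖g x‖ := by
      refine (Complex.re_le_norm _).trans ?_
      rw [norm_mul, norm_mul, RCLike.norm_conj]
      exact mul_le_mul_of_nonneg_right (mul_le_of_le_one_left (norm_nonneg _) hFx) (norm_nonneg _)
    rw [Complex.mul_conj, Complex.mul_conj, Complex.normSq_eq_norm_sq, Complex.normSq_eq_norm_sq,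
      Complex.sub_re, Complex.add_re, Complex.ofReal_re, Complex.ofReal_re]
    have h2 : (2 * ((F x * k x) * (starRingEnd ℂ) (g x))).re =
      2 * ((F x * k x) * (starRingEnd ℂ) (g x)).re := by simp
    rw [h2]
    nlinarith [sq_nonneg (‖k x‖ - ‖g x‖)]
  rw [integral_sub i12 (i3.const_mul 2), integral_add i1 i2, integral_const_mul, hfk',
    hgg, hkk] at key
  convert key using 2
  rw [show ∀ A B : ℂ, A + B - 2 * B = A - B from fun A B => by ring, ← Finset.sum_sub_distrib]
  refine Finset.sum_congr rfl fun i _ => ?_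
  simp only [hg, hk, hb, Finset.mul_sum]
  rw [← Finset.sum_sub_distrib]
  refine Finset.sum_congr rfl fun j _ => ?_
  simp only [map_mul, Complex.conj_conj]
  ring

end SzegoPick

open Filter Topology

/-- Necessity of positivity of the Pick matrix formed with the Szegő kernel
`(1 - ⟨λᵢ,λⱼ⟩)^{-d}` for `H^∞`-interpolation on the unit ball of `ℂ^d`. -/
theorem stmt9 (d n : ℕ) (hd : 0 < d)
    (lam : Fin n → EuclideanSpace ℂ (Fin d))
    (hmem : ∀ i, lam i ∈ ball (0 : EuclideanSpace ℂ (Fin d)) 1)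
    (hinj : Function.Injective lam) (z : Fin n → ℂ)
    (hphi : ∃ φ : EuclideanSpace ℂ (Fin d) → ℂ,
      DifferentiableOn ℂ φ (ball (0 : EuclideanSpace ℂ (Fin d)) 1) ∧
      (∀ w ∈ ball (0 : EuclideanSpace ℂ (Fin d)) 1, ‖φ w‖ ≤ 1) ∧
      ∀ i, φ (lam i) = z i) :
    (Matrix.of fun i j : Fin n =>
      (1 - z i * (starRingEnd ℂ) (z j)) *
        ((1 - ∑ k, lam i k * (starRingEnd ℂ) (lam j k)) ^ d)⁻¹).PosSemidef := by
  obtain ⟨m, rfl⟩ : ∃ m, d = m + 1 := ⟨d - 1, by omega⟩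
  obtain ⟨φ, hφd, hφ1, hφz⟩ := hphi
  have hl : ∀ i, ‖lam i‖ < 1 := fun i => by simpa using hmem i
  have hK : ∀ i j, ((1 - ∑ k, lam i k * (starRingEnd ℂ) (lam j k)) ^ (m + 1))⁻¹ =
      SzegoPick.KK (lam j) (lam i) := by
    intro i j
    simp only [SzegoPick.KK, PiLp.inner_apply, RCLike.inner_apply]
  simp only [hK]
  have hherm : (Matrix.of fun i j : Fin n =>
      (1 - z i * (starRingEnd ℂ) (z j)) * SzegoPick.KK (lam j) (lam i)).IsHermitian := by
    ext i j
    simp only [Matrix.conjTranspose_apply, Matrix.of_apply]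
    change (starRingEnd ℂ) _ = _
    rw [map_mul, SzegoPick.KK_conj]
    simp only [map_sub, map_one, map_mul, Complex.conj_conj]
    rw [SzegoPick.KK]
    ring
  refine .of_dotProduct_mulVec_nonneg hherm fun x => ?_
  have him := hherm.im_star_dotProduct_mulVec_self x
  rw [Complex.nonneg_iff]
  refine ⟨?_, him.symm⟩
  -- common radius
  obtain ⟨ρ, hρ0, hρ1, hρ⟩ : ∃ ρ : ℝ, 0 < ρ ∧ ρ < 1 ∧ ∀ i, ‖lam i‖ ≤ ρ := by
    have : ∀ᶠ ρ : ℝ in 𝓝[<] 1, (0 < ρ ∧ ρ < 1) ∧ ∀ i, ‖lam i‖ ≤ ρ := by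
      refine Filter.Eventually.and (Ioo_mem_nhdsLT one_pos) ?_
      rw [Filter.eventually_all]
      intro i
      filter_upwards [Ioo_mem_nhdsLT (hl i)] with r hr using hr.1.le
    obtain ⟨ρ, h1, h2⟩ := this.exists
    exact ⟨ρ, h1.1, h1.2, h2⟩
  let Q : (Fin n → ℂ) → ℝ := fun y => (∑ i, ∑ j, (starRingEnd ℂ) (x i) *
    ((1 - y i * (starRingEnd ℂ) (y j)) * SzegoPick.KK (lam j) (lam i)) * x j).re
  have hQc : Continuous Q := by
    fun_prop
  have hQr : ∀ r : ℝ, ρ < r → r < 1 → 0 ≤ Q (fun i => φ ((r : ℂ) • lam i)) := by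
    intro r hr0 hr1
    have hr : 0 < r := hρ0.trans hr0
    have hmaps : ∀ y : SzegoPick.SV m, y ∈ ball (0 : SzegoPick.SV m) r⁻¹ →
        (r : ℂ) • y ∈ ball (0 : SzegoPick.SV m) 1 := by
      intro y hy
      have hy' : ‖y‖ < r⁻¹ := by simpa using hy
      simp only [mem_ball_zero_iff, norm_smul, Complex.norm_real, Real.norm_eq_abs, abs_of_pos hr]
      calc r * ‖y‖ < r * r⁻¹ := by gcongr
        _ = 1 := mul_inv_cancel₀ hr.ne'
    refine SzegoPick.pick_aux (F := fun y => φ ((r : ℂ) • y)) (R := r⁻¹)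
      ((one_lt_inv₀ hr).2 hr1) ?_ ?_ hl ?_ x
    · exact hφd.comp (by fun_prop) hmaps
    · exact fun y hy => hφ1 _ (hmaps y hy)
    · intro i
      calc ‖lam i‖ * r⁻¹ ≤ r * r⁻¹ := by
            gcongr
            exact (hρ i).trans hr0.le
        _ = 1 := mul_inv_cancel₀ hr.ne'
  have hlim : Tendsto (fun r : ℝ => Q (fun i => φ ((r : ℂ) • lam i))) (𝓝[<] 1) (𝓝 (Q z)) := by
    refine (hQc.tendsto z).comp (tendsto_pi_nhds.2 fun i => ?_)
    rw [← hφz i]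
    have h1 : ContinuousAt φ (lam i) :=
      (hφd.differentiableAt (isOpen_ball.mem_nhds (hmem i))).continuousAt
    have h2 : Tendsto (fun r : ℝ => (r : ℂ) • lam i) (𝓝 1) (𝓝 (lam i)) := by
      have : Continuous (fun r : ℝ => (r : ℂ) • lam i) := by fun_prop
      simpa using this.tendsto 1
    exact h1.tendsto.comp (h2.mono_left nhdsWithin_le_nhds)
  have hQz : 0 ≤ Q z := by
    refine ge_of_tendsto hlim ?_
    filter_upwards [Ioo_mem_nhdsLT hρ1] with r hr using hQr r hr.1 hr.2
  convert hQz using 2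
  simp only [dotProduct, Matrix.mulVec, Matrix.of_apply, Finset.mul_sum, Pi.star_apply]
  refine Finset.sum_congr rfl fun i _ => Finset.sum_congr rfl fun j _ => ?_
  change (starRingEnd ℂ) (x i) * _ = _
  ring
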